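/- The system of equations -x₁²x₂² - 5x₂²u₂² + 3x₁²u₂ + 3x₂²u₂ = 0, -80x₁x₂² + 10x₂³ + 20x₁² + 21x₂² + 5x₂²u₂ = 0, -10x₁²x₂ - 5x₂³ + 6x₁² + 5x₂² = 0 has exactly four solutions (u₂, x₁, x₂) with u₂ > 0, x₁ > 0, x₂ > 0. -/

import Mathlib

/-- Eliminating `u₂`, `x₁`, `x₂` in favour of the ratio `t = x₁ / x₂` turns the Einstein system
on `E₆/A₄` into the vanishing of this polynomial. -/
def einsteinPoly (t : ℝ) : ℝ :=
  2635 - 13000 * t + 28735 * t ^ 2 - 47000 * t ^ 3 + 60750 * t ^ 4 - 54880 * t ^ 5 +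
    39868 * t ^ 6 - 20640 * t ^ 7 + 4600 * t ^ 8

/-- The derivative of `einsteinPoly`. -/
def einsteinPolyDeriv (t : ℝ) : ℝ :=
  -13000 + 57470 * t - 141000 * t ^ 2 + 243000 * t ^ 3 - 274400 * t ^ 4 + 239208 * t ^ 5 -
    144480 * t ^ 6 + 36800 * t ^ 7

theorem continuous_einsteinPoly : Continuous einsteinPoly := by
  unfold einsteinPoly
  fun_prop

theorem deriv_einsteinPoly (t : ℝ) : deriv einsteinPoly t = einsteinPolyDeriv t := by
  have h (n : ℕ) (c : ℝ) : HasDerivAt (fun s : ℝ => c * s ^ n) (c * (n * t ^ (n - 1))) t :=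
    (hasDerivAt_pow n t).const_mul c
  have key := ((((((((hasDerivAt_const t (2635 : ℝ)).add (h 1 (-13000))).add (h 2 28735)).add
    (h 3 (-47000))).add (h 4 60750)).add (h 5 (-54880))).add (h 6 39868)).add
    (h 7 (-20640))).add (h 8 4600)
  convert key.deriv using 1
  · congr 1
    ext s
    simp only [einsteinPoly, Pi.add_apply]
    ring
  · simp only [einsteinPolyDeriv]
    norm_num
    ring

theorem sub_pow_mul_sub_pow_nonneg {a b t : ℝ} (ha : a ≤ t) (hb : t ≤ b) (i j : ℕ) :
    0 ≤ (t - a) ^ i * (b - t) ^ j :=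
  mul_nonneg (pow_nonneg (sub_nonneg.2 ha) i) (pow_nonneg (sub_nonneg.2 hb) j)

theorem einsteinPolyDeriv_neg_left {t : ℝ} (ha : 0 ≤ t) (hb : t ≤ 27 / 50) :
    einsteinPolyDeriv t < 0 := by
  have B := sub_pow_mul_sub_pow_nonneg ha hb
  unfold einsteinPolyDeriv
  linarith [B 0 7, B 1 6, B 2 5, B 3 4, B 4 3, B 5 2, B 6 1, B 7 0]

theorem einsteinPoly_neg_left {t : ℝ} (ha : 27 / 50 ≤ t) (hb : t ≤ 59 / 100) :
    einsteinPoly t < 0 := by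
  have B := sub_pow_mul_sub_pow_nonneg ha hb
  unfold einsteinPoly
  linarith [B 0 8, B 1 7, B 2 6, B 3 5, B 4 4, B 5 3, B 6 2, B 7 1, B 8 0]

theorem einsteinPolyDeriv_pos_left {t : ℝ} (ha : 59 / 100 ≤ t) (hb : t ≤ 11 / 10) :
    0 < einsteinPolyDeriv t := by
  have B := sub_pow_mul_sub_pow_nonneg ha hb
  unfold einsteinPolyDeriv
  linarith [B 0 7, B 1 6, B 2 5, B 3 4, B 4 3, B 5 2, B 6 1, B 7 0]

theorem einsteinPoly_pos_middle {t : ℝ} (ha : 11 / 10 ≤ t) (hb : t ≤ 13 / 10) :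
    0 < einsteinPoly t := by
  have B := sub_pow_mul_sub_pow_nonneg ha hb
  unfold einsteinPoly
  linarith [B 0 8, B 1 7, B 2 6, B 3 5, B 4 4, B 5 3, B 6 2, B 7 1, B 8 0]

theorem einsteinPolyDeriv_neg_right {t : ℝ} (ha : 13 / 10 ≤ t) (hb : t ≤ 8 / 5) :
    einsteinPolyDeriv t < 0 := by
  have B := sub_pow_mul_sub_pow_nonneg ha hb
  unfold einsteinPolyDeriv
  linarith [B 0 7, B 1 6, B 2 5, B 3 4, B 4 3, B 5 2, B 6 1, B 7 0]

theorem einsteinPoly_neg_right {t : ℝ} (ha : 8 / 5 ≤ t) (hb : t ≤ 7 / 4) :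
    einsteinPoly t < 0 := by
  have B := sub_pow_mul_sub_pow_nonneg ha hb
  unfold einsteinPoly
  linarith [B 0 8, B 1 7, B 2 6, B 3 5, B 4 4, B 5 3, B 6 2, B 7 1, B 8 0]

theorem einsteinPolyDeriv_pos_right {t : ℝ} (ha : 7 / 4 ≤ t) : 0 < einsteinPolyDeriv t := by
  have B (i : ℕ) : 0 ≤ (t - 7 / 4) ^ i := pow_nonneg (sub_nonneg.2 ha) i
  unfold einsteinPolyDeriv
  linarith [B 1, B 2, B 3, B 4, B 5, B 6, B 7]

theorem injOn_einsteinPoly_of_deriv_neg {s : Set ℝ} (hs : Convex ℝ s)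
    (h : ∀ t ∈ s, einsteinPolyDeriv t < 0) : Set.InjOn einsteinPoly s :=
  (strictAntiOn_of_deriv_neg hs continuous_einsteinPoly.continuousOn fun t ht => by
    rw [deriv_einsteinPoly]; exact h t (interior_subset ht)).injOn

theorem injOn_einsteinPoly_of_deriv_pos {s : Set ℝ} (hs : Convex ℝ s)
    (h : ∀ t ∈ s, 0 < einsteinPolyDeriv t) : Set.InjOn einsteinPoly s :=
  (strictMonoOn_of_deriv_pos hs continuous_einsteinPoly.continuousOn fun t ht => by
    rw [deriv_einsteinPoly]; exact h t (interior_subset ht)).injOn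

/-- `einsteinPoly` has exactly four positive zeros. -/
theorem exists_finset_pos_roots_einsteinPoly :
    ∃ R : Finset ℝ, R.card = 4 ∧ ∀ t, t ∈ R ↔ 0 < t ∧ einsteinPoly t = 0 := by
  have hc {a b : ℝ} : ContinuousOn einsteinPoly (Set.Icc a b) :=
    continuous_einsteinPoly.continuousOn
  obtain ⟨a, ⟨ha₀, ha₁⟩, ha⟩ : (0 : ℝ) ∈ einsteinPoly '' Set.Ioo 0 (27 / 50) :=
    intermediate_value_Ioo' (by norm_num) hc (by constructor <;> norm_num [einsteinPoly])
  obtain ⟨b, ⟨hb₀, hb₁⟩, hb⟩ : (0 : ℝ) ∈ einsteinPoly '' Set.Ioo (59 / 100) (11 / 10) :=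
    intermediate_value_Ioo (by norm_num) hc (by constructor <;> norm_num [einsteinPoly])
  obtain ⟨c, ⟨hc₀, hc₁⟩, hc'⟩ : (0 : ℝ) ∈ einsteinPoly '' Set.Ioo (13 / 10) (8 / 5) :=
    intermediate_value_Ioo' (by norm_num) hc (by constructor <;> norm_num [einsteinPoly])
  obtain ⟨d, ⟨hd₀, -⟩, hd⟩ : (0 : ℝ) ∈ einsteinPoly '' Set.Ioo (7 / 4) 2 :=
    intermediate_value_Ioo (by norm_num) hc (by constructor <;> norm_num [einsteinPoly])
  have hab : a < b := by linarith
  have hbc : b < c := by linarith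
  have hcd : c < d := by linarith
  refine ⟨{a, b, c, d}, ?_, fun t => ?_⟩
  · rw [Finset.card_eq_succ]
    refine ⟨a, {b, c, d}, ?_, rfl, Finset.card_eq_three.2
      ⟨b, c, d, hbc.ne, (hbc.trans hcd).ne, hcd.ne, rfl⟩⟩
    simp [hab.ne, (hab.trans hbc).ne, (hab.trans (hbc.trans hcd)).ne]
  simp only [Finset.mem_insert, Finset.mem_singleton]
  constructor
  · rintro (rfl | rfl | rfl | rfl)
    · exact ⟨ha₀, ha⟩
    · exact ⟨by linarith, hb⟩
    · exact ⟨by linarith, hc'⟩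
    · exact ⟨by linarith, hd⟩
  · rintro ⟨ht, h⟩
    rcases le_total t (27 / 50) with h₁ | h₁
    · exact .inl <| injOn_einsteinPoly_of_deriv_neg (convex_Icc 0 (27 / 50))
        (fun s hs => einsteinPolyDeriv_neg_left hs.1 hs.2) ⟨ht.le, h₁⟩ ⟨ha₀.le, ha₁.le⟩
        (h.trans ha.symm)
    rcases le_total t (59 / 100) with h₂ | h₂
    · exact absurd h (einsteinPoly_neg_left h₁ h₂).ne
    rcases le_total t (11 / 10) with h₃ | h₃
    · exact .inr <| .inl <| injOn_einsteinPoly_of_deriv_pos (convex_Icc (59 / 100) (11 / 10))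
        (fun s hs => einsteinPolyDeriv_pos_left hs.1 hs.2) ⟨h₂, h₃⟩ ⟨hb₀.le, hb₁.le⟩
        (h.trans hb.symm)
    rcases le_total t (13 / 10) with h₄ | h₄
    · exact absurd h (einsteinPoly_pos_middle h₃ h₄).ne'
    rcases le_total t (8 / 5) with h₅ | h₅
    · exact .inr <| .inr <| .inl <| injOn_einsteinPoly_of_deriv_neg
        (convex_Icc (13 / 10) (8 / 5))
        (fun s hs => einsteinPolyDeriv_neg_right hs.1 hs.2) ⟨h₄, h₅⟩ ⟨hc₀.le, hc₁.le⟩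
        (h.trans hc'.symm)
    rcases le_total t (7 / 4) with h₆ | h₆
    · exact absurd h (einsteinPoly_neg_right h₅ h₆).ne
    · exact .inr <| .inr <| .inr <| injOn_einsteinPoly_of_deriv_pos (convex_Ici (7 / 4))
        (fun s hs => einsteinPolyDeriv_pos_right hs) h₆ hd₀.le (h.trans hd.symm)

/-- The value of `x₂` in terms of `t = x₁ / x₂`. -/
noncomputable def einsteinX₂ (t : ℝ) : ℝ := (5 + 6 * t ^ 2) / (5 + 10 * t ^ 2)

/-- The value of `u₂` in terms of `t = x₁ / x₂`. -/
noncomputable def einsteinU₂ (t : ℝ) : ℝ :=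
  (-155 + 400 * t - 370 * t ^ 2 + 480 * t ^ 3 - 200 * t ^ 4) / (5 * (5 + 10 * t ^ 2))

theorem einsteinX₂_pos (t : ℝ) : 0 < einsteinX₂ t := by
  unfold einsteinX₂
  positivity

/-- The first equation of the system, divided by `x₂ ^ 2`, in terms of `t = x₁ / x₂`. -/
theorem einstein_eq_iff_einsteinPoly_eq_zero (t : ℝ) :
    -t ^ 2 * einsteinX₂ t ^ 2 - 5 * einsteinU₂ t ^ 2 + 3 * (1 + t ^ 2) * einsteinU₂ t = 0 ↔
      einsteinPoly t = 0 := by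
  have hD : 5 + 10 * t ^ 2 ≠ 0 := by positivity
  have key : -t ^ 2 * einsteinX₂ t ^ 2 - 5 * einsteinU₂ t ^ 2 +
      3 * (1 + t ^ 2) * einsteinU₂ t = -(2 * einsteinPoly t / (5 + 10 * t ^ 2) ^ 2) := by
    unfold einsteinX₂ einsteinU₂ einsteinPoly
    field_simp
    ring
  rw [key, neg_eq_zero, div_eq_zero_iff]
  simp [hD]

theorem einsteinU₂_pos {t : ℝ} (ht : 0 < t) (h : einsteinPoly t = 0) : 0 < einsteinU₂ t := by
  have h₁ := (einstein_eq_iff_einsteinPoly_eq_zero t).2 h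
  have h₂ : 0 < t ^ 2 * einsteinX₂ t ^ 2 := by
    have := einsteinX₂_pos t
    positivity
  refine pos_of_mul_pos_right (a := 3 * (1 + t ^ 2)) ?_ (by positivity)
  nlinarith [sq_nonneg (einsteinU₂ t)]

theorem einsteinX₂_unique {t x : ℝ} (hx : x ≠ 0)
    (h : -10 * (t * x) ^ 2 * x - 5 * x ^ 3 + 6 * (t * x) ^ 2 + 5 * x ^ 2 = 0) :
    x = einsteinX₂ t := by
  have hD : 5 + 10 * t ^ 2 ≠ 0 := by positivity
  rw [einsteinX₂, eq_div_iff hD]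
  refine mul_left_cancel₀ (pow_ne_zero 2 hx) ?_
  linarith

theorem einsteinU₂_unique {t x u : ℝ} (hx : x ≠ 0) (hxt : x = einsteinX₂ t)
    (h : -80 * (t * x) * x ^ 2 + 10 * x ^ 3 + 20 * (t * x) ^ 2 + 21 * x ^ 2 +
      5 * x ^ 2 * u = 0) :
    u = einsteinU₂ t := by
  have hD : 5 + 10 * t ^ 2 ≠ 0 := by positivity
  have h₁ : 5 * u = 80 * t * x - 10 * x - 20 * t ^ 2 - 21 := by
    refine mul_left_cancel₀ (pow_ne_zero 2 hx) ?_
    linarith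
  rw [einsteinX₂, eq_div_iff hD] at hxt
  rw [einsteinU₂, eq_div_iff (by positivity)]
  linear_combination (5 + 10 * t ^ 2) * h₁ + (80 * t - 10) * hxt

/-- The Einstein system on `E₆/A₄` has exactly four positive solutions. -/
theorem e6_a4_exactly_four_solutions :
    ∃ S : Finset (ℝ × ℝ × ℝ), S.card = 4 ∧
      ∀ p : ℝ × ℝ × ℝ, p ∈ S ↔
        (0 < p.1 ∧ 0 < p.2.1 ∧ 0 < p.2.2 ∧
         -p.2.1 ^ 2 * p.2.2 ^ 2 - 5 * p.2.2 ^ 2 * p.1 ^ 2 + 3 * p.2.1 ^ 2 * p.1 +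
           3 * p.2.2 ^ 2 * p.1 = 0 ∧
         -80 * p.2.1 * p.2.2 ^ 2 + 10 * p.2.2 ^ 3 + 20 * p.2.1 ^ 2 + 21 * p.2.2 ^ 2 +
           5 * p.2.2 ^ 2 * p.1 = 0 ∧
         -10 * p.2.1 ^ 2 * p.2.2 - 5 * p.2.2 ^ 3 + 6 * p.2.1 ^ 2 + 5 * p.2.2 ^ 2 = 0) := by
  obtain ⟨R, hcard, hR⟩ := exists_finset_pos_roots_einsteinPoly
  have hinj : Function.Injective fun t : ℝ => (einsteinU₂ t, t * einsteinX₂ t, einsteinX₂ t) := by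
    intro s t h
    simp only [Prod.mk.injEq] at h
    obtain ⟨-, h₁, h₂⟩ := h
    rw [h₂] at h₁
    exact mul_right_cancel₀ (einsteinX₂_pos t).ne' h₁
  refine ⟨R.map ⟨_, hinj⟩, by rw [Finset.card_map, hcard], ?_⟩
  rintro ⟨u, v, x⟩
  simp only [Finset.mem_map, hR, Function.Embedding.coeFn_mk, Prod.mk.injEq]
  constructor
  · rintro ⟨t, ⟨ht, h⟩, rfl, rfl, rfl⟩
    have hD : 5 + 10 * t ^ 2 ≠ 0 := by positivity
    refine ⟨einsteinU₂_pos ht h, mul_pos ht (einsteinX₂_pos t), einsteinX₂_pos t, ?_, ?_, ?_⟩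
    · linear_combination einsteinX₂ t ^ 2 * (einstein_eq_iff_einsteinPoly_eq_zero t).2 h
    · unfold einsteinX₂ einsteinU₂
      field_simp
      ring
    · unfold einsteinX₂
      field_simp
      ring
  · rintro ⟨-, hv, hx, h₁, h₂, h₃⟩
    obtain ⟨t, rfl⟩ : ∃ t, v = t * x := ⟨v / x, (div_mul_cancel₀ v hx.ne').symm⟩
    have ht : 0 < t := pos_of_mul_pos_left hv hx.le
    have hxt := einsteinX₂_unique hx.ne' h₃
    have hut := einsteinU₂_unique hx.ne' hxt h₂
    refine ⟨t, ⟨ht, (einstein_eq_iff_einsteinPoly_eq_zero t).1 ?_⟩, hut.symm, by rw [← hxt],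
      hxt.symm⟩
    rw [← hxt, ← hut]
    refine mul_left_cancel₀ (pow_ne_zero 2 hx.ne') ?_
    linear_combination h₁
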